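/- arXiv:quant-ph/0607018 — 3 statements merged into one kernel-verified Lean document; each statement's English description precedes it below -/
import Mathlib

section
/- Let Ω be a finite probability space, T a finite type, X : Ω → ZMod 2 a uniformly distributed random bit, and (U, S) : Ω → ZMod 2 × T a pair of random variables such that X is independent of the pair (U, S). Then the Shannon mutual information (with natural logarithm) between X and the pair (X + U, S) satisfies I[ X : ⟨X + U, S⟩ ] = Real.log 2 − H[ U | S ], where H[U | S] is the conditional Shannon entropy of U given S. -/
/-- Shannon entropy (natural logarithm) of a random variable `Y` on a finite probability
space with weights `P`: `H[Y] = Σ_t negMulLog (Prob(Y = t))`. -/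
noncomputable def shannonEntropy {Ω T : Type*} [Fintype Ω] [Fintype T] [DecidableEq T]
    (P : Ω → ℝ) (Y : Ω → T) : ℝ :=
  ∑ t : T, Real.negMulLog (∑ ω ∈ Finset.univ.filter (fun ω => Y ω = t), P ω)

/-- Conditional Shannon entropy `H[U | S] = H[(U, S)] − H[S]`. -/
noncomputable def condShannonEntropy {Ω T T' : Type*} [Fintype Ω] [Fintype T] [Fintype T']
    [DecidableEq T] [DecidableEq T'] (P : Ω → ℝ) (U : Ω → T) (S : Ω → T') : ℝ :=
  shannonEntropy P (fun ω => (U ω, S ω)) - shannonEntropy P S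

/-- Shannon mutual information `I[X : Y] = H[X] + H[Y] − H[(X, Y)]`. -/
noncomputable def mutualInfo {Ω T T' : Type*} [Fintype Ω] [Fintype T] [Fintype T']
    [DecidableEq T] [DecidableEq T'] (P : Ω → ℝ) (X : Ω → T) (Y : Ω → T') : ℝ :=
  shannonEntropy P X + shannonEntropy P Y - shannonEntropy P (fun ω => (X ω, Y ω))

theorem sum_prob_eq_one {Ω T : Type*} [Fintype Ω] [Fintype T] [DecidableEq T]
    {P : Ω → ℝ} (hP1 : ∑ ω, P ω = 1) (Y : Ω → T) :
    ∑ t, ∑ ω ∈ Finset.univ.filter (fun ω => Y ω = t), P ω = 1 := by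
  rw [Finset.sum_fiberwise, hP1]

theorem shannonEntropy_equiv_comp {Ω T T' : Type*} [Fintype Ω] [Fintype T] [Fintype T']
    [DecidableEq T] [DecidableEq T'] (P : Ω → ℝ) (Y : Ω → T) (e : T ≃ T') :
    shannonEntropy P (fun ω => e (Y ω)) = shannonEntropy P Y := by
  unfold shannonEntropy
  rw [← e.sum_comp]
  simp only [e.apply_eq_iff_eq]

theorem shannonEntropy_prodMk_of_indep {Ω T T' : Type*} [Fintype Ω] [Fintype T] [Fintype T']
    [DecidableEq T] [DecidableEq T'] {P : Ω → ℝ} (hP1 : ∑ ω, P ω = 1) (Y : Ω → T) (Z : Ω → T')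
    (h : ∀ y z, ∑ ω ∈ Finset.univ.filter (fun ω => Y ω = y ∧ Z ω = z), P ω =
      (∑ ω ∈ Finset.univ.filter (fun ω => Y ω = y), P ω) *
        ∑ ω ∈ Finset.univ.filter (fun ω => Z ω = z), P ω) :
    shannonEntropy P (fun ω => (Y ω, Z ω)) = shannonEntropy P Y + shannonEntropy P Z := by
  unfold shannonEntropy
  simp only [Fintype.sum_prod_type, Prod.mk.injEq, h, Real.negMulLog_mul, Finset.sum_add_distrib,
    ← Finset.sum_mul, ← Finset.mul_sum, sum_prob_eq_one hP1, one_mul]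

theorem shannonEntropy_uniform_bit {Ω : Type*} [Fintype Ω] {P : Ω → ℝ} {X : Ω → ZMod 2}
    (hX : ∀ x, ∑ ω ∈ Finset.univ.filter (fun ω => X ω = x), P ω = 1 / 2) :
    shannonEntropy P X = Real.log 2 := by
  simp [shannonEntropy, hX, Real.negMulLog]

/-- The shear `(x, u, s) ↦ (x, x + u, s)`. -/
def shearEquiv (G T : Type*) [AddGroup G] : G × G × T ≃ G × G × T where
  toFun p := (p.1, p.1 + p.2.1, p.2.2)
  invFun p := (p.1, -p.1 + p.2.1, p.2.2)
  left_inv p := by simp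
  right_inv p := by simp

/-- If `X` is a uniformly distributed random bit, independent of the pair `(U, S)`, then
`I[X : ⟨X + U, S⟩] = log 2 − H[U | S]`. -/
theorem mutualInfo_shifted_bit (Ω T : Type*) [Fintype Ω] [Fintype T] [DecidableEq T]
    (P : Ω → ℝ) (hP0 : ∀ ω, 0 ≤ P ω) (hP1 : ∑ ω, P ω = 1)
    (X U : Ω → ZMod 2) (S : Ω → T)
    (hX_unif : ∀ x : ZMod 2,
      ∑ ω ∈ Finset.univ.filter (fun ω => X ω = x), P ω = 1 / 2)
    (h_indep : ∀ (x u : ZMod 2) (s : T),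
      ∑ ω ∈ Finset.univ.filter (fun ω => X ω = x ∧ U ω = u ∧ S ω = s), P ω =
        (∑ ω ∈ Finset.univ.filter (fun ω => X ω = x), P ω) *
          (∑ ω ∈ Finset.univ.filter (fun ω => U ω = u ∧ S ω = s), P ω)) :
    mutualInfo P X (fun ω => (X ω + U ω, S ω)) =
      Real.log 2 - condShannonEntropy P U S := by
  have h_sum : ∀ b s, ∑ ω ∈ Finset.univ.filter (fun ω => X ω + U ω = b ∧ S ω = s), P ω =
      1 / 2 * ∑ ω ∈ Finset.univ.filter (fun ω => S ω = s), P ω := by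
    intro b s
    rw [← Finset.sum_fiberwise _ X, ← Finset.sum_fiberwise (Finset.univ.filter _) U,
      Finset.mul_sum, ← (Equiv.subLeft b).sum_comp]
    refine Finset.sum_congr rfl fun u _ => ?_
    have h := h_indep (b - u) u s
    rw [hX_unif] at h
    simp only [Finset.filter_filter, Equiv.subLeft_apply]
    convert h using 3
    · constructor
      · rintro ⟨⟨h1, h2⟩, h3⟩
        exact ⟨h3, by linear_combination h1 - h3, h2⟩
      · rintro ⟨h1, h2, h3⟩
        exact ⟨⟨by linear_combination h1 + h2, h3⟩, h1⟩
    · simp only [and_comm]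
  have h_unif : ∀ b, ∑ ω ∈ Finset.univ.filter (fun ω => X ω + U ω = b), P ω = 1 / 2 := by
    intro b
    rw [← Finset.sum_fiberwise _ S]
    simp only [Finset.filter_filter, h_sum, ← Finset.mul_sum, sum_prob_eq_one hP1, mul_one]
  have h_received : shannonEntropy P (fun ω => (X ω + U ω, S ω)) =
      Real.log 2 + shannonEntropy P S := by
    rw [shannonEntropy_prodMk_of_indep hP1 (fun ω => X ω + U ω) S
      (fun b s => by rw [h_sum, h_unif]), shannonEntropy_uniform_bit h_unif]
  have h_joint : shannonEntropy P (fun ω => (X ω, X ω + U ω, S ω)) =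
      Real.log 2 + shannonEntropy P (fun ω => (U ω, S ω)) := by
    rw [← shannonEntropy_uniform_bit hX_unif,
      ← shannonEntropy_prodMk_of_indep hP1 X (fun ω => (U ω, S ω))
        (fun x p => by simpa only [Prod.ext_iff] using h_indep x p.1 p.2)]
    exact shannonEntropy_equiv_comp P (fun ω => (X ω, U ω, S ω)) (shearEquiv (ZMod 2) T)
  rw [mutualInfo, condShannonEntropy, shannonEntropy_uniform_bit hX_unif, h_received, h_joint]
  ring
end

section
/- Let m = n + 1 ≥ 1 and p ∈ (0,1). Let (U, S) be a pair of random variables with values in ZMod 2 × (Fin n → ZMod 2) whose joint law is P^p_m. Then the conditional Shannon entropy (natural logarithm) of U given S equals H[U | S] = Σ_{w=0}^{n} (n choose w) · ( p^{m−w}(1−p)^{w} + p^{w}(1−p)^{m−w} ) · h( p^{m−w}(1−p)^{w} / ( p^{m−w}(1−p)^{w} + p^{w}(1−p)^{m−w} ) ), where h(x) = −x log x − (1−x) log(1−x) is the natural-logarithm binary entropy (Real.binEntropy). -/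
/-- The joint distribution `P^p_m(u, s)` of logical bit error `u` and syndrome `s`
for the `m = n+1` qubit repetition code correcting independent bit errors of
probability `p`: with `w` the Hamming weight of `s`, it is `p^{m−w}(1−p)^w` if `u = 1`
and `p^w (1−p)^{m−w}` if `u = 0`. -/
noncomputable def Pjoint (n : ℕ) (p : ℝ) (u : ZMod 2) (s : Fin n → ZMod 2) : ℝ :=
  if u = 1 then
    p ^ (n + 1 - (Finset.univ.filter fun j => s j = 1).card) *
      (1 - p) ^ (Finset.univ.filter fun j => s j = 1).card
  else
    p ^ (Finset.univ.filter fun j => s j = 1).card *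
      (1 - p) ^ (n + 1 - (Finset.univ.filter fun j => s j = 1).card)

/-- The two-outcome chain rule: splitting a mass `a + b` into `a` and `b` adds
`(a + b) h(a / (a + b))` to the entropy. -/
theorem negMulLog_add_negMulLog_sub {a b : ℝ} (ha : 0 < a) (hb : 0 < b) :
    Real.negMulLog a + Real.negMulLog b - Real.negMulLog (a + b) =
      (a + b) * Real.binEntropy (a / (a + b)) := by
  have hab : a + b ≠ 0 := (add_pos ha hb).ne'
  have h : 1 - a / (a + b) = b / (a + b) := by
    field_simp
    ring
  rw [Real.binEntropy_eq_negMulLog_add_negMulLog_one_sub, h]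
  simp only [Real.negMulLog]
  rw [Real.log_div ha.ne' hab, Real.log_div hb.ne' hab]
  field_simp
  ring

/-- A sum over bit strings of a function of the Hamming weight, grouped by weight. -/
theorem sum_hammingWeight {ι : Type*} [Fintype ι] [DecidableEq ι] (f : ℕ → ℝ) :
    ∑ s : ι → ZMod 2, f (Finset.univ.filter fun j => s j = 1).card =
      ∑ w ∈ Finset.range (Fintype.card ι + 1), ((Fintype.card ι).choose w : ℝ) * f w := by
  have hcount := Finset.sum_powerset_apply_card f (x := (Finset.univ : Finset ι))
  simp only [nsmul_eq_mul, Finset.card_univ, Finset.powerset_univ] at hcount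
  rw [← hcount]
  refine Finset.sum_nbij' (fun s => Finset.univ.filter fun j => s j = 1)
    (fun t j => if j ∈ t then 1 else 0) (by simp) (by simp) ?_ ?_ (by simp)
  · intro s _
    funext j
    have hbit : ∀ x : ZMod 2, (if x = 1 then 1 else 0) = x := by decide
    simpa using hbit (s j)
  · intro t _
    ext j
    simp

/-- For `(U, S)` distributed according to `P^p_m` (with `m = n+1`, `p ∈ (0,1)`), the
conditional entropy of the logical bit error given the syndrome is
`H[U|S] = Σ_w C(n,w)(p^{m−w}(1−p)^w + p^w(1−p)^{m−w})
          h(p^{m−w}(1−p)^w / (p^{m−w}(1−p)^w + p^w(1−p)^{m−w}))`,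
with `h` the natural-log binary entropy. -/
theorem condEntropy_repetition_code (n : ℕ) (p : ℝ) (hp : p ∈ Set.Ioo (0 : ℝ) 1)
    (Ω : Type*) [Fintype Ω] (P : Ω → ℝ) (hP0 : ∀ ω, 0 ≤ P ω) (hP1 : ∑ ω, P ω = 1)
    (U : Ω → ZMod 2) (S : Ω → Fin n → ZMod 2)
    (hlaw : ∀ (u : ZMod 2) (s : Fin n → ZMod 2),
      ∑ ω ∈ Finset.univ.filter (fun ω => U ω = u ∧ S ω = s), P ω = Pjoint n p u s) :
    condShannonEntropy P U S =
      ∑ w ∈ Finset.range (n + 1), (n.choose w : ℝ) *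
        (p ^ (n + 1 - w) * (1 - p) ^ w + p ^ w * (1 - p) ^ (n + 1 - w)) *
        Real.binEntropy (p ^ (n + 1 - w) * (1 - p) ^ w /
          (p ^ (n + 1 - w) * (1 - p) ^ w + p ^ w * (1 - p) ^ (n + 1 - w))) := by
  obtain ⟨hp0, hp1⟩ := hp
  have hq0 : 0 < 1 - p := sub_pos.mpr hp1
  have hmarg (s : Fin n → ZMod 2) :
      ∑ ω ∈ Finset.univ.filter (fun ω => S ω = s), P ω =
        Pjoint n p 1 s + Pjoint n p 0 s := by
    have hbit : ∀ x : ZMod 2, ¬x = 1 ↔ x = 0 := by decide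
    rw [← hlaw, ← hlaw, ← Finset.sum_filter_add_sum_filter_not _ (fun ω => U ω = 1)]
    simp only [Finset.filter_filter, hbit, and_comm]
  have hsum (g : ZMod 2 → ℝ) : ∑ u, g u = g 1 + g 0 := by
    rw [add_comm]
    exact Fin.sum_univ_two g
  have hweight := sum_hammingWeight (ι := Fin n) fun w =>
    (p ^ (n + 1 - w) * (1 - p) ^ w + p ^ w * (1 - p) ^ (n + 1 - w)) *
      Real.binEntropy (p ^ (n + 1 - w) * (1 - p) ^ w /
        (p ^ (n + 1 - w) * (1 - p) ^ w + p ^ w * (1 - p) ^ (n + 1 - w)))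
  simp only [Fintype.card_fin, ← mul_assoc] at hweight
  rw [← hweight, condShannonEntropy, shannonEntropy, shannonEntropy,
    Fintype.sum_prod_type_right, ← Finset.sum_sub_distrib]
  refine Finset.sum_congr rfl fun s _ => ?_
  simp only [Prod.mk.injEq, hlaw, hmarg, hsum]
  have hne : (0 : ZMod 2) ≠ 1 := by decide
  simp only [Pjoint, if_true, if_neg hne]
  exact negMulLog_add_negMulLog_sub (by positivity) (by positivity)
end

section
/- Define H₂(x) = −x · log x / log 2 − (1−x) · log(1−x) / log 2 (binary entropy base 2) and the m = 1 key rate r₁(p,q) = 1 − H₂(p + q − 2pq) + H₂( (1 − √(1 − 16 p (1−p) q (1−q)))/2 ) − H₂(p). Then r₁(11/100, 3/10) > 0. -/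
/-- Binary entropy, base 2: `H₂(x) = −x log₂ x − (1−x) log₂ (1−x)`. -/
noncomputable def H2 (x : ℝ) : ℝ :=
  -x * Real.log x / Real.log 2 - (1 - x) * Real.log (1 - x) / Real.log 2

/-- The `m = 1` key rate of BB84 with noisy processing at bit error rate `p` and added
noise rate `q`:
`r₁(p,q) = 1 − H₂(p + q − 2pq) + H₂((1 − √(1 − 16p(1−p)q(1−q)))/2) − H₂(p)`. -/
noncomputable def keyRate1 (p q : ℝ) : ℝ :=
  1 - H2 (p + q - 2 * p * q) +
    H2 ((1 - Real.sqrt (1 - 16 * p * (1 - p) * q * (1 - q))) / 2) - H2 p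

lemma abs_sum_range_ten_add_log_le (y : ℝ) (hy : |1 - y| < 1) :
    |(∑ i ∈ Finset.range 10, (1 - y) ^ (i + 1) / (i + 1)) + Real.log y| ≤
      |1 - y| ^ 11 / (1 - |1 - y|) := by
  simpa using Real.abs_log_sub_add_sum_range_le hy 10

lemma H2_eq_binEntropy_div (x : ℝ) : H2 x = Real.binEntropy x / Real.log 2 := by
  rw [H2, Real.binEntropy, Real.log_inv, Real.log_inv]
  ring

lemma binEntropy_sum_lt_log_two_add :
    Real.binEntropy (43 / 125) + Real.binEntropy (11 / 100) <
      Real.log 2 + Real.binEntropy (9 / 100) := by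
  have l43 : Real.log (43 / 125) = Real.log (86 / 125) - Real.log 2 := by
    rw [← Real.log_div (by norm_num) (by norm_num)]; norm_num
  have l11 : Real.log (11 / 100) = Real.log (22 / 25) - 3 * Real.log 2 := by
    rw [show (3 : ℝ) * Real.log 2 = Real.log (2 ^ 3) by rw [Real.log_pow]; norm_num,
      ← Real.log_div (by norm_num) (by norm_num)]
    norm_num
  have l9 : Real.log (9 / 100) = Real.log (18 / 25) - 3 * Real.log 2 := by
    rw [show (3 : ℝ) * Real.log 2 = Real.log (2 ^ 3) by rw [Real.log_pow]; norm_num,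
      ← Real.log_div (by norm_num) (by norm_num)]
    norm_num
  have b86 := abs_le.mp (abs_sum_range_ten_add_log_le (86 / 125) (by norm_num [abs_lt]))
  have b82 := abs_le.mp (abs_sum_range_ten_add_log_le (82 / 125) (by norm_num [abs_lt]))
  have b22 := abs_le.mp (abs_sum_range_ten_add_log_le (22 / 25) (by norm_num [abs_lt]))
  have b89 := abs_le.mp (abs_sum_range_ten_add_log_le (89 / 100) (by norm_num [abs_lt]))
  have b18 := abs_le.mp (abs_sum_range_ten_add_log_le (18 / 25) (by norm_num [abs_lt]))
  have b91 := abs_le.mp (abs_sum_range_ten_add_log_le (91 / 100) (by norm_num [abs_lt]))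
  norm_num [Finset.sum_range_succ, abs_of_pos] at b86 b82 b22 b89 b18 b91
  simp only [Real.binEntropy, Real.log_inv]
  norm_num only
  rw [l43, l11, l9]
  linarith [Real.log_two_gt_d9, Real.log_two_lt_d9, b86.1, b82.1, b22.1, b89.1, b18.2, b91.2]

/-- The `m = 1` noisy-processing key rate is positive at bit error rate `p = 0.11` with
added noise `q = 0.3`. -/
theorem keyRate1_pos_at_bit_error_rate_011 : keyRate1 (11 / 100) (3 / 10) > 0 := by
  have hlog : 0 < Real.log 2 := Real.log_pos one_lt_two
  have hsqrt : √(1 - 16 * (11 / 100) * (1 - 11 / 100) * (3 / 10) * (1 - 3 / 10)) ≤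
      (41 / 50 : ℝ) := by
    rw [Real.sqrt_le_left (by norm_num)]
    norm_num
  rw [keyRate1]
  set s := √(1 - 16 * (11 / 100) * (1 - 11 / 100) * (3 / 10) * (1 - 3 / 10) : ℝ) with hs
  have hs0 : 0 ≤ s := Real.sqrt_nonneg _
  have hmono : Real.binEntropy (9 / 100) ≤ Real.binEntropy ((1 - s) / 2) :=
    Real.binEntropy_strictMonoOn.monotoneOn (by norm_num)
      ⟨by linarith, by linarith⟩ (by linarith)
  have hp : (11 / 100 + 3 / 10 - 2 * (11 / 100) * (3 / 10) : ℝ) = 43 / 125 := by norm_num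
  simp only [H2_eq_binEntropy_div, hp]
  have hsum : 1 - Real.binEntropy (43 / 125) / Real.log 2 +
      Real.binEntropy ((1 - s) / 2) / Real.log 2 - Real.binEntropy (11 / 100) / Real.log 2 =
      (Real.log 2 - Real.binEntropy (43 / 125) + Real.binEntropy ((1 - s) / 2) -
        Real.binEntropy (11 / 100)) / Real.log 2 := by
    field_simp
  rw [hsum]
  exact div_pos (by linarith [binEntropy_sum_lt_log_two_add]) hlog
end
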